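/- arXiv:1610.05229 — 2 statements merged into one kernel-verified Lean document; each statement's English description precedes it below -/
import Mathlib

section
/- Interpolation inequality between sup norm, L² norm and Hölder seminorm: let α ∈ (0,1], let a < b be reals, and let f : [a,b] → ℝ^d be continuous with finite α-Hölder seminorm H := sup_{s≠t, s,t∈[a,b]} |f(t) − f(s)| / |t − s|^α. Then sup_{t∈[a,b]} |f(t)| ≤ 2 · max( (b − a)^{−1/2} · ‖f‖_{L²}, ‖f‖_{L²}^{2α/(2α+1)} · H^{1/(2α+1)} ), where ‖f‖_{L²} := ( ∫_a^b |f(t)|² dt )^{1/2}. -/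
/-- If `f` satisfies a Hölder bound whose oscillation over distance `l ≤ b - a` is at most
`‖f t‖ / 2`, then its squared `L²` norm is at least `l * (‖f t‖ / 2) ^ 2`. -/
theorem mul_half_norm_sq_le_integral {E : Type*} [NormedAddCommGroup E] {α a b H l t : ℝ}
    (hα : 0 ≤ α) {f : ℝ → E} (hf : ContinuousOn f (Set.Icc a b)) (hH0 : 0 ≤ H)
    (hH : ∀ s ∈ Set.Icc a b, ∀ t ∈ Set.Icc a b, ‖f t - f s‖ ≤ H * |t - s| ^ α)
    (ht : t ∈ Set.Icc a b) (hl0 : 0 ≤ l) (hl : l ≤ b - a) (hHl : H * l ^ α ≤ ‖f t‖ / 2) :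
    l * (‖f t‖ / 2) ^ 2 ≤ ∫ u in a..b, ‖f u‖ ^ 2 := by
  obtain ⟨c, hac, hct, htc, hcb⟩ : ∃ c, a ≤ c ∧ c ≤ t ∧ t ≤ c + l ∧ c + l ≤ b := by
    refine ⟨max a (t - l), le_max_left _ _, max_le ht.1 (by linarith), ?_, ?_⟩
    · linarith [le_max_right a (t - l)]
    · have : max a (t - l) ≤ b - l := max_le (by linarith) (by linarith [ht.2])
      linarith
  have hcont : ContinuousOn (fun u => ‖f u‖ ^ 2) (Set.Icc a b) := hf.norm.pow 2
  have hlow : ∀ u ∈ Set.Icc c (c + l), (‖f t‖ / 2) ^ 2 ≤ ‖f u‖ ^ 2 := by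
    intro u hu
    have h1 := hH u ⟨hac.trans hu.1, hu.2.trans hcb⟩ t ht
    have h2 : |t - u| ^ α ≤ l ^ α := by
      apply Real.rpow_le_rpow (abs_nonneg _) _ hα
      rw [abs_le]
      constructor <;> linarith [hu.1, hu.2]
    have h3 := mul_le_mul_of_nonneg_left h2 hH0
    have h4 := norm_sub_norm_le (f t) (f u)
    exact pow_le_pow_left₀ (by positivity) (by linarith) 2
  calc l * (‖f t‖ / 2) ^ 2 = ∫ _ in c..(c + l), (‖f t‖ / 2) ^ 2 := by simp
    _ ≤ ∫ u in c..(c + l), ‖f u‖ ^ 2 :=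
        intervalIntegral.integral_mono_on (by linarith) intervalIntegrable_const
          ((hcont.mono (Set.Icc_subset_Icc hac hcb)).intervalIntegrable_of_Icc (by linarith)) hlow
    _ ≤ ∫ u in a..b, ‖f u‖ ^ 2 :=
        intervalIntegral.integral_mono_interval hac (by linarith) hcb
          (Filter.Eventually.of_forall fun u => by positivity)
          (hcont.intervalIntegrable_of_Icc (by linarith))

/-- Interpolation inequality between the sup norm, the `L²` norm and the `α`-Hölder
seminorm: if `f : [a,b] → ℝ^d` is continuous and `H` is its `α`-Hölder seminorm
(i.e. `‖f t - f s‖ ≤ H |t - s|^α` for all `s, t ∈ [a,b]`), then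
`sup_{[a,b]} ‖f‖ ≤ 2 max( (b-a)^{-1/2} ‖f‖_{L²}, ‖f‖_{L²}^{2α/(2α+1)} H^{1/(2α+1)} )`. -/
theorem statement9 (d : ℕ) (α a b : ℝ) (hα0 : 0 < α) (hα1 : α ≤ 1) (hab : a < b)
    (f : ℝ → EuclideanSpace ℝ (Fin d)) (hf : ContinuousOn f (Set.Icc a b))
    (H : ℝ) (hH0 : 0 ≤ H)
    (hH : ∀ s ∈ Set.Icc a b, ∀ t ∈ Set.Icc a b, ‖f t - f s‖ ≤ H * |t - s| ^ α) :
    ∀ t ∈ Set.Icc a b,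
      ‖f t‖ ≤ 2 * max
        ((b - a) ^ (-(1 / 2) : ℝ) * (∫ u in a..b, ‖f u‖ ^ 2) ^ ((1 : ℝ) / 2))
        ((∫ u in a..b, ‖f u‖ ^ 2) ^ (α / (2 * α + 1)) * H ^ (1 / (2 * α + 1))) := by
  intro t ht
  have hL0 : 0 ≤ ∫ u in a..b, ‖f u‖ ^ 2 :=
    intervalIntegral.integral_nonneg hab.le fun u _ => by positivity
  have key := fun l => mul_half_norm_sq_le_integral (l := l) hα0.le hf hH0 hH ht
  set L := ∫ u in a..b, ‖f u‖ ^ 2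
  obtain ⟨m, hm⟩ : ∃ m, m = ‖f t‖ / 2 := ⟨_, rfl⟩
  have hm0 : 0 ≤ m := by rw [hm]; positivity
  rw [← hm] at key
  suffices h : m ≤ max ((b - a) ^ (-(1 / 2) : ℝ) * L ^ ((1 : ℝ) / 2))
      (L ^ (α / (2 * α + 1)) * H ^ (1 / (2 * α + 1))) by linarith
  have hba : 0 < b - a := sub_pos.2 hab
  by_cases hcase : H * (b - a) ^ α ≤ m
  · refine le_max_of_le_left ?_
    have h1 := key (b - a) hba.le le_rfl hcase
    rw [Real.rpow_neg hba.le, ← Real.inv_rpow hba.le,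
      ← Real.mul_rpow (inv_nonneg.2 hba.le) hL0, ← Real.sqrt_eq_rpow]
    apply Real.le_sqrt_of_sq_le
    rwa [inv_mul_eq_div, le_div_iff₀' hba]
  · refine le_max_of_le_right ?_
    rw [not_le] at hcase
    have hHpos : 0 < H := by
      refine hH0.lt_of_ne fun h => ?_
      rw [← h, zero_mul] at hcase
      linarith
    have hq0 : 0 ≤ m / H := by positivity
    have hl : (m / H) ^ α⁻¹ ≤ b - a := by
      rw [Real.rpow_inv_le_iff_of_pos hq0 hba.le hα0, div_le_iff₀' hHpos]
      exact hcase.le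
    have h1 := key ((m / H) ^ α⁻¹) (by positivity) hl
      (by rw [Real.rpow_inv_rpow hq0 hα0.ne', mul_div_cancel₀ _ hHpos.ne'])
    have h2 : m / H * m ^ (2 * α) ≤ L ^ α := by
      have h3 := Real.rpow_le_rpow (by positivity) h1 hα0.le
      rwa [Real.mul_rpow (by positivity) (by positivity), Real.rpow_inv_rpow hq0 hα0.ne',
        ← Real.rpow_natCast_mul hm0, Nat.cast_ofNat] at h3
    have h4 : m ^ (2 * α + 1) ≤ L ^ α * H := by
      rw [Real.rpow_add_one' hm0 (by positivity)]
      rw [div_mul_eq_mul_div, div_le_iff₀ hHpos] at h2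
      linarith
    have h5 : m ≤ (L ^ α * H) ^ (2 * α + 1)⁻¹ :=
      (Real.le_rpow_inv_iff_of_pos hm0 (by positivity) (by positivity)).2 h4
    rwa [Real.mul_rpow (by positivity) hH0, ← Real.rpow_mul hL0, ← div_eq_mul_inv,
      ← one_div] at h5
end

section
/- Norris-type lemma for rough paths (Lemma 4.1, stated concretely): fix T > 0, α ∈ (1/3, 1/2), θ ∈ (1/2, 2α) and an integer n ≥ 1. There exist constants C > 0, p > 0 and r > 0, depending only on α, θ, n and T, such that the following holds. Let (X, 𝕏) be an α-Hölder rough path with values in ℝⁿ such that X is θ-Hölder rough on scale T/2 with modulus L > 0. Let (A, A') be controlled by X with values in L(ℝⁿ, ℝ), let B : [0,T] → ℝ satisfy ‖B‖_α < ∞, and let Z : [0,T] → ℝ and K ≥ 0 be such that for all 0 ≤ s ≤ t ≤ T, |Z_t − Z_s − B_s·(t − s) − A_s(X_t − X_s) − A'_s(𝕏_{s,t})| ≤ K·((t − s)^{3α} + (t − s)^{1+α}). Then sup_{[0,T]}|A| + sup_{[0,T]}|B| ≤ C · ℛ^p · (sup_{[0,T]}|Z|)^r, where ℛ := 1 + L^{−1}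 + ‖X‖_α + ‖𝕏‖_{2α}^{1/2} + |A₀| + |A'₀| + ‖A'‖_α + ‖R^A‖_{2α} + sup_{[0,T]}|B| + ‖B‖_α + K. -/
open Filter

/-- Optimising over the scale `ε = c * w ^ (1 / γ)`. -/
lemma le_rpow_of_scale_bound {c q γ w y N M : ℝ} (hc : 0 < c) (hγ : 0 < γ) (hw : 0 < w)
    (h : y * (c * w ^ (1 / γ)) ^ q ≤ N * w + M * (c * w ^ (1 / γ)) ^ γ) :
    y ≤ c ^ (-q) * (N + M * c ^ γ) * w ^ (1 - q / γ) := by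
  have hγ0 : γ ≠ 0 := hγ.ne'
  have e1 : (c * w ^ (1 / γ)) ^ γ = c ^ γ * w := by
    rw [Real.mul_rpow hc.le (by positivity), ← Real.rpow_mul hw.le, one_div_mul_cancel hγ0,
      Real.rpow_one]
  have e2 : (c * w ^ (1 / γ)) ^ q = c ^ q * w ^ (q / γ) := by
    rw [Real.mul_rpow hc.le (by positivity), ← Real.rpow_mul hw.le, one_div_mul_eq_div]
  rw [e1, e2] at h
  have e3 : w ^ (1 - q / γ) = w / w ^ (q / γ) := by
    rw [Real.rpow_sub hw, Real.rpow_one]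
  rw [e3, Real.rpow_neg hc.le]
  have h1 : 0 < c ^ q := by positivity
  have h2 : 0 < w ^ (q / γ) := by positivity
  have e4 : (c ^ q)⁻¹ * (N + M * c ^ γ) * (w / w ^ (q / γ))
      = (N * w + M * (c ^ γ * w)) / (c ^ q * w ^ (q / γ)) := by
    field_simp
  rw [e4, le_div_iff₀ (by positivity)]
  exact h

/-- Smallness of the derivative of a path controlled by a Hölder rough path. -/
lemma abs_le_of_holderRough {T θ γ L w N M : ℝ} {n : ℕ} {X : ℝ → EuclideanSpace ℝ (Fin n)}
    (hT : 0 < T) (hγ : 0 < γ) (hL : 0 < L) (hw : 0 < w) (hw1 : w ≤ 1) (hM : 0 ≤ M) (hN : 0 ≤ N)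
    (hrough : ∀ φ : EuclideanSpace ℝ (Fin n), φ ≠ 0 →
      ∀ s ∈ Set.Icc (0 : ℝ) T, ∀ ε : ℝ, 0 < ε → ε < T / 2 →
        ∃ t ∈ Set.Icc (0 : ℝ) T, |t - s| ≤ ε ∧
          L * ε ^ θ * ‖φ‖ ≤ |∑ k : Fin n, φ k * (X t k - X s k)|)
    {s : ℝ} (hs : s ∈ Set.Icc (0 : ℝ) T) (v : Fin n → ℝ)
    (hv : ∀ t ∈ Set.Icc (0 : ℝ) T,
      |∑ k, v k * (X t k - X s k)| ≤ N * w + M * |t - s| ^ γ) (k : Fin n) :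
    |v k| ≤ L⁻¹ * ((T / 4) ^ (-θ) * (N + M * (T / 4) ^ γ) * w ^ (1 - θ / γ)) := by
  by_cases h0 : WithLp.toLp 2 v = 0
  · have : v k = 0 := by
      have := congrArg (fun x : EuclideanSpace ℝ (Fin n) => x k) h0
      simpa using this
    rw [this, abs_zero]
    positivity
  have hw1' : w ^ (1 / γ) ≤ 1 := Real.rpow_le_one hw.le hw1 (by positivity)
  have hwp : 0 < w ^ (1 / γ) := by positivity
  obtain ⟨t, ht, hts, hLt⟩ := hrough _ h0 s hs (T / 4 * w ^ (1 / γ)) (by positivity)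
    (by nlinarith)
  have hb : |v k| ≤ ‖WithLp.toLp 2 v‖ := by
    simpa using PiLp.norm_apply_le (WithLp.toLp 2 v) k
  refine hb.trans ?_
  rw [inv_mul_eq_div, le_div_iff₀ hL]
  apply le_rpow_of_scale_bound (by positivity) hγ hw
  have hvt := hv t ht
  have : |t - s| ^ γ ≤ (T / 4 * w ^ (1 / γ)) ^ γ :=
    Real.rpow_le_rpow (abs_nonneg _) hts hγ.le
  have h3 := mul_le_mul_of_nonneg_left this hM
  have h4 : L * (T / 4 * w ^ (1 / γ)) ^ θ * ‖WithLp.toLp 2 v‖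
      ≤ |∑ k, v k * (X t k - X s k)| := hLt
  linarith

lemma abs_sum_mul_le {n : ℕ} {x y : Fin n → ℝ} {a b : ℝ} (hx : ∀ k, |x k| ≤ a)
    (hy : ∀ k, |y k| ≤ b) : |∑ k, x k * y k| ≤ n * (a * b) := by
  calc |∑ k, x k * y k| ≤ ∑ k, |x k * y k| := Finset.abs_sum_le_sum_abs _ _
    _ ≤ ∑ _k : Fin n, a * b := Finset.sum_le_sum fun k _ => by
        rw [abs_mul]
        exact mul_le_mul (hx k) (hy k) (abs_nonneg _) ((abs_nonneg _).trans (hx k))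
    _ = n * (a * b) := by simp

lemma abs_le_sqrt_sum_sq {ι : Type*} [Fintype ι] (x : ι → ℝ) (i : ι) :
    |x i| ≤ Real.sqrt (∑ j, x j ^ 2) :=
  Real.abs_le_sqrt (Finset.single_le_sum (f := fun j => x j ^ 2)
    (fun _ _ => sq_nonneg _) (Finset.mem_univ i))

lemma sqrt_sum_sq_le {n : ℕ} {x : Fin n → ℝ} {a : ℝ} (ha : 0 ≤ a) (hx : ∀ k, |x k| ≤ a) :
    Real.sqrt (∑ k, x k ^ 2) ≤ n * a := by
  rcases Nat.eq_zero_or_pos n with rfl | hn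
  · simp
  have hn1 : (1 : ℝ) ≤ n := by exact_mod_cast hn
  apply Real.sqrt_le_iff.2 ⟨by positivity, ?_⟩
  calc ∑ k, x k ^ 2 ≤ ∑ _k : Fin n, a ^ 2 := Finset.sum_le_sum fun k _ => by
        rw [← sq_abs]; exact pow_le_pow_left₀ (abs_nonneg _) (hx k) 2
    _ = n * a ^ 2 := by simp
    _ ≤ (n * a) ^ 2 := by
        rw [mul_pow]; gcongr; nlinarith

/-- The hypotheses of the Norris-type lemma, written in coordinates and with a single constant `Q`
dominating all the quantities involved. -/
structure NorrisBounds (T α θ Q : ℝ) {n : ℕ} (X : ℝ → EuclideanSpace ℝ (Fin n))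
    (XX : ℝ → ℝ → Fin n → Fin n → ℝ) (A : ℝ → Fin n → ℝ) (A' : ℝ → Fin n → Fin n → ℝ)
    (B Z : ℝ → ℝ) : Prop where
  T_pos : 0 < T
  lt_alpha : 1 / 3 < α
  alpha_lt : α < 1 / 2
  lt_theta : 1 / 2 < θ
  theta_lt : θ < 2 * α
  ten_le : 10 ≤ Q
  dim_le : (n : ℝ) ≤ Q
  rpow_le : ∀ h γ : ℝ, 0 ≤ h → h ≤ T → 0 ≤ γ → γ ≤ 2 → h ^ γ ≤ Q
  scale_le : (T / 4) ^ (-θ) ≤ Q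
  scale_inv_le : (T / 4) ^ (-1 : ℝ) ≤ Q
  path_le : ∀ s t : ℝ, 0 ≤ s → s ≤ t → t ≤ T → ∀ k, |X t k - X s k| ≤ Q * (t - s) ^ α
  area_le : ∀ s t : ℝ, 0 ≤ s → s ≤ t → t ≤ T → ∀ k l,
    |XX s t k l| ≤ Q ^ 2 * (t - s) ^ (2 * α)
  rough : ∀ φ : EuclideanSpace ℝ (Fin n), φ ≠ 0 →
    ∀ s ∈ Set.Icc (0 : ℝ) T, ∀ ε : ℝ, 0 < ε → ε < T / 2 →
      ∃ t ∈ Set.Icc (0 : ℝ) T, |t - s| ≤ ε ∧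
        Q⁻¹ * ε ^ θ * ‖φ‖ ≤ |∑ k : Fin n, φ k * (X t k - X s k)|
  init_le : ∀ k, |A 0 k| ≤ Q
  deriv_init_le : ∀ k l, |A' 0 k l| ≤ Q
  deriv_le : ∀ s t : ℝ, 0 ≤ s → s ≤ t → t ≤ T → ∀ k l,
    |A' t k l - A' s k l| ≤ Q * (t - s) ^ α
  remainder_le : ∀ s t : ℝ, 0 ≤ s → s ≤ t → t ≤ T → ∀ l,
    |A t l - A s l - ∑ k : Fin n, (X t k - X s k) * A' s k l| ≤ Q * (t - s) ^ (2 * α)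
  drift_le : ∀ s ∈ Set.Icc (0 : ℝ) T, |B s| ≤ Q
  drift_incr_le : ∀ s t : ℝ, 0 ≤ s → s ≤ t → t ≤ T → |B t - B s| ≤ Q * (t - s) ^ α
  integral_le : ∀ s t : ℝ, 0 ≤ s → s ≤ t → t ≤ T →
    |Z t - Z s - B s * (t - s) - (∑ k : Fin n, (X t k - X s k) * A s k)
        - ∑ k : Fin n, ∑ l : Fin n, XX s t k l * A' s k l|
      ≤ Q * ((t - s) ^ (3 * α) + (t - s) ^ (1 + α))

namespace NorrisBounds

variable {T α θ Q w : ℝ} {n : ℕ} {X : ℝ → EuclideanSpace ℝ (Fin n)}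
  {XX : ℝ → ℝ → Fin n → Fin n → ℝ} {A : ℝ → Fin n → ℝ} {A' : ℝ → Fin n → Fin n → ℝ}
  {B Z : ℝ → ℝ}

lemma Q_pos (H : NorrisBounds T α θ Q X XX A A' B Z) : 0 < Q := by linarith [H.ten_le]

lemma ten_mul_pow_le (H : NorrisBounds T α θ Q X XX A A' B Z) {i j : ℕ} (hij : i < j) :
    10 * Q ^ i ≤ Q ^ j := by
  have h := H.ten_le
  calc 10 * Q ^ i ≤ Q * Q ^ i := by gcongr
    _ = Q ^ (i + 1) := by ring
    _ ≤ Q ^ j := pow_le_pow_right₀ (by linarith) hij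

lemma dim_mul_le (H : NorrisBounds T α θ Q X XX A A' B Z) {x : ℝ} (hx : 0 ≤ x) :
    n * x ≤ Q * x := mul_le_mul_of_nonneg_right H.dim_le hx

/-- On `[0, T]`, raising the exponent costs at most a factor `Q`. -/
lemma rpow_le_mul_rpow (H : NorrisBounds T α θ Q X XX A A' B Z) {h β γ : ℝ} (h0 : 0 ≤ h)
    (hT : h ≤ T) (hγ : 0 < γ) (hβ : γ ≤ β) (hβ2 : β ≤ 2) : h ^ β ≤ Q * h ^ γ := by
  have e : h ^ β = h ^ (β - γ) * h ^ γ := by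
    rw [← Real.rpow_add' h0 (by linarith)]; congr 1; ring
  rw [e]
  exact mul_le_mul_of_nonneg_right (H.rpow_le h _ h0 hT (by linarith) (by linarith))
    (by positivity)

lemma deriv_abs_le (H : NorrisBounds T α θ Q X XX A A' B Z) {s : ℝ} (hs : s ∈ Set.Icc 0 T)
    (k l : Fin n) : |A' s k l| ≤ Q ^ 3 := by
  have h1 := H.deriv_le 0 s le_rfl hs.1 hs.2 k l
  have h2 := H.deriv_init_le k l
  have h3 := H.rpow_le s α hs.1 hs.2 (by linarith [H.lt_alpha]) (by linarith [H.alpha_lt])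
  rw [sub_zero] at h1
  have h4 := mul_le_mul_of_nonneg_left h3 H.Q_pos.le
  have h5 := abs_sub_abs_le_abs_sub (A' s k l) (A' 0 k l)
  have p1 := H.ten_mul_pow_le (show 1 < 3 by norm_num)
  have p2 := H.ten_mul_pow_le (show 2 < 3 by norm_num)
  have := H.Q_pos
  nlinarith [pow_pos this 3]

lemma incr_abs_le (H : NorrisBounds T α θ Q X XX A A' B Z) {s t : ℝ} (hs : 0 ≤ s)
    (hst : s ≤ t) (ht : t ≤ T) (l : Fin n) : |A t l - A s l| ≤ Q ^ 6 * (t - s) ^ α := by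
  have hQ := H.Q_pos
  have h1 := H.remainder_le s t hs hst ht l
  have h0 : 0 ≤ t - s := by linarith
  have h2 := H.rpow_le_mul_rpow h0 (by linarith) (by linarith [H.lt_alpha])
    (show α ≤ 2 * α by linarith [H.lt_alpha]) (by linarith [H.alpha_lt])
  have h3 := abs_sum_mul_le (H.path_le s t hs hst ht)
    (fun k => H.deriv_abs_le ⟨hs, hst.trans ht⟩ k l)
  have hh : 0 ≤ (t - s) ^ α := by positivity
  have h4 := H.dim_mul_le (x := Q * (t - s) ^ α * Q ^ 3) (by positivity)
  have h5 := abs_sub_abs_le_abs_sub (A t l - A s l) (∑ k : Fin n, (X t k - X s k) * A' s k l)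
  have h6 := mul_le_mul_of_nonneg_left h2 hQ.le
  have p1 := mul_le_mul_of_nonneg_right (H.ten_mul_pow_le (show 5 < 6 by norm_num)) hh
  have p2 := mul_le_mul_of_nonneg_right (H.ten_mul_pow_le (show 2 < 6 by norm_num)) hh
  have e : 0 ≤ Q ^ 6 * (t - s) ^ α := by positivity
  linarith

lemma integrand_abs_le (H : NorrisBounds T α θ Q X XX A A' B Z) {s : ℝ} (hs : s ∈ Set.Icc 0 T)
    (k : Fin n) : |A s k| ≤ Q ^ 8 := by
  have hQ := H.Q_pos
  have h1 := H.incr_abs_le le_rfl hs.1 hs.2 k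
  have h2 := H.init_le k
  have h3 := H.rpow_le s α hs.1 hs.2 (by linarith [H.lt_alpha]) (by linarith [H.alpha_lt])
  rw [sub_zero] at h1
  have h4 := mul_le_mul_of_nonneg_left h3 (pow_pos hQ 6).le
  have h5 := abs_sub_abs_le_abs_sub (A s k) (A 0 k)
  have p1 := H.ten_mul_pow_le (show 1 < 8 by norm_num)
  have p2 := H.ten_mul_pow_le (show 7 < 8 by norm_num)
  have := pow_pos hQ 8
  linarith

lemma area_sum_le (H : NorrisBounds T α θ Q X XX A A' B Z) {s t a : ℝ} (hs : 0 ≤ s)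
    (hst : s ≤ t) (ht : t ≤ T) (ha : 0 ≤ a) (hA' : ∀ k l, |A' s k l| ≤ a) :
    |∑ k : Fin n, ∑ l : Fin n, XX s t k l * A' s k l| ≤ Q ^ 4 * a * (t - s) ^ (2 * α) := by
  have hQ := H.Q_pos
  have hh : 0 ≤ (t - s) ^ (2 * α) := Real.rpow_nonneg (by linarith) _
  have h1 := fun k => abs_sum_mul_le (H.area_le s t hs hst ht k) (hA' k)
  have h2 := abs_sum_mul_le h1 (y := fun _ => 1) (b := 1) (by simp)
  simp only [mul_one] at h2
  refine h2.trans ?_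
  have h3 := H.dim_mul_le (x := Q ^ 2 * (t - s) ^ (2 * α) * a) (by positivity)
  have h4 := H.dim_mul_le (x := n * (Q ^ 2 * (t - s) ^ (2 * α) * a)) (by positivity)
  have h5 := mul_le_mul_of_nonneg_left h3 hQ.le
  linarith

lemma integrand_forward_le (H : NorrisBounds T α θ Q X XX A A' B Z)
    (hZ : ∀ t ∈ Set.Icc 0 T, |Z t| ≤ w) {s t : ℝ} (hs : 0 ≤ s) (hst : s ≤ t) (ht : t ≤ T) :
    |∑ k : Fin n, (X t k - X s k) * A s k| ≤ 2 * w + Q ^ 8 * (t - s) ^ (2 * α) := by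
  have hQ := H.Q_pos
  have ha := H.lt_alpha
  have ha' := H.alpha_lt
  have h0 : 0 ≤ t - s := by linarith
  have hhT : t - s ≤ T := by linarith
  have hh : 0 ≤ (t - s) ^ (2 * α) := by positivity
  have h1 := H.integral_le s t hs hst ht
  have h2 := H.area_sum_le hs hst ht (by positivity)
    (fun k l => H.deriv_abs_le ⟨hs, hst.trans ht⟩ k l)
  have hb : |B s * (t - s)| ≤ Q * (Q * (t - s) ^ (2 * α)) := by
    rw [abs_mul, abs_of_nonneg h0]
    have := H.rpow_le_mul_rpow h0 hhT (by linarith) (show 2 * α ≤ 1 by linarith) (by norm_num)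
    rw [Real.rpow_one] at this
    exact mul_le_mul (H.drift_le s ⟨hs, hst.trans ht⟩) this h0 hQ.le
  have h3 := H.rpow_le_mul_rpow h0 hhT (by linarith) (show 2 * α ≤ 3 * α by linarith)
    (by linarith)
  have h4 := H.rpow_le_mul_rpow h0 hhT (by linarith) (show 2 * α ≤ 1 + α by linarith)
    (by linarith)
  have h5 := mul_le_mul_of_nonneg_left (add_le_add h3 h4) hQ.le
  have z1 := abs_le.1 (hZ t ⟨hs.trans hst, ht⟩)
  have z2 := abs_le.1 (hZ s ⟨hs, hst.trans ht⟩)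
  have p1 := mul_le_mul_of_nonneg_right (H.ten_mul_pow_le (show 7 < 8 by norm_num)) hh
  have p2 := mul_le_mul_of_nonneg_right (H.ten_mul_pow_le (show 2 < 8 by norm_num)) hh
  have e : 0 ≤ Q ^ 8 * (t - s) ^ (2 * α) := by positivity
  rw [abs_le] at *
  constructor <;> linarith

lemma integrand_incr_le (H : NorrisBounds T α θ Q X XX A A' B Z)
    (hZ : ∀ t ∈ Set.Icc 0 T, |Z t| ≤ w) {s t : ℝ} (hs : s ∈ Set.Icc 0 T)
    (ht : t ∈ Set.Icc 0 T) :
    |∑ k, A s k * (X t k - X s k)| ≤ 2 * w + Q ^ 9 * |t - s| ^ (2 * α) := by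
  have hQ := H.Q_pos
  have ha := H.lt_alpha
  have hh : 0 ≤ |t - s| ^ (2 * α) := by positivity
  have p1 := mul_le_mul_of_nonneg_right (H.ten_mul_pow_le (show 8 < 9 by norm_num)) hh
  have e : 0 ≤ Q ^ 9 * |t - s| ^ (2 * α) := by positivity
  rcases le_total s t with hst | hst
  · have h := H.integrand_forward_le hZ hs.1 hst ht.2
    rw [abs_of_nonneg (show 0 ≤ t - s by linarith)] at *
    simp only [mul_comm (A s _)]
    linarith
  · have h := H.integrand_forward_le hZ ht.1 hst hs.2
    have h0 : 0 ≤ s - t := by linarith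
    rw [abs_sub_comm, abs_of_nonneg h0] at *
    have h1 := abs_sum_mul_le (fun k => H.incr_abs_le ht.1 hst hs.2 k)
      (H.path_le t s ht.1 hst hs.2)
    have h2 : (s - t) ^ (2 * α) = (s - t) ^ α * (s - t) ^ α := by
      rw [← Real.rpow_add' h0 (by linarith)]; congr 1; ring
    have h3 := H.dim_mul_le (x := Q ^ 6 * (s - t) ^ α * (Q * (s - t) ^ α)) (by positivity)
    have h4 : ∑ k, A s k * (X t k - X s k) = -(∑ k, (A s k - A t k) * (X s k - X t k)
        + ∑ k, (X s k - X t k) * A t k) := by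
      rw [← Finset.sum_add_distrib, ← Finset.sum_neg_distrib]
      exact Finset.sum_congr rfl fun k _ => by ring
    rw [h4, abs_neg]
    refine (abs_add_le _ _).trans ?_
    have h5 : Q * (Q ^ 6 * (s - t) ^ α * (Q * (s - t) ^ α)) = Q ^ 8 * (s - t) ^ (2 * α) := by
      rw [h2]; ring
    linarith

lemma integrand_small (H : NorrisBounds T α θ Q X XX A A' B Z)
    (hZ : ∀ t ∈ Set.Icc 0 T, |Z t| ≤ w) (hw : 0 < w) (hw1 : w ≤ 1) {s : ℝ}
    (hs : s ∈ Set.Icc 0 T) (k : Fin n) : |A s k| ≤ Q ^ 13 * w ^ (1 - θ / (2 * α)) := by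
  have hQ := H.Q_pos
  have ha := H.lt_alpha
  have h := abs_le_of_holderRough H.T_pos (show 0 < 2 * α by linarith) (inv_pos.2 hQ) hw hw1
    (by positivity) zero_le_two H.rough hs (A s) (fun t ht => H.integrand_incr_le hZ hs ht) k
  refine h.trans ?_
  rw [inv_inv, ← mul_assoc]
  have hT := H.T_pos
  gcongr
  have h1 := H.rpow_le (T / 4) (2 * α) (by linarith) (by linarith) (by linarith)
    (by linarith [H.alpha_lt])
  calc Q * ((T / 4) ^ (-θ) * (2 + Q ^ 9 * (T / 4) ^ (2 * α)))
      ≤ Q * (Q * (2 + Q ^ 9 * Q)) := by gcongr; exact H.scale_le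
    _ ≤ Q ^ 13 := by
      have p1 := H.ten_mul_pow_le (show 12 < 13 by norm_num)
      have p2 := H.ten_mul_pow_le (show 2 < 13 by norm_num)
      have := pow_pos hQ 13
      linarith

lemma deriv_incr_le (H : NorrisBounds T α θ Q X XX A A' B Z) {a : ℝ}
    (hA : ∀ t ∈ Set.Icc 0 T, ∀ k, |A t k| ≤ a) {s t : ℝ} (hs : s ∈ Set.Icc 0 T)
    (ht : t ∈ Set.Icc 0 T) (l : Fin n) :
    |∑ k, A' s k l * (X t k - X s k)| ≤ 2 * a + Q ^ 4 * |t - s| ^ (2 * α) := by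
  have hQ := H.Q_pos
  have ha := H.lt_alpha
  have hh : 0 ≤ |t - s| ^ (2 * α) := by positivity
  have p1 := mul_le_mul_of_nonneg_right (H.ten_mul_pow_le (show 3 < 4 by norm_num)) hh
  have p2 := mul_le_mul_of_nonneg_right (H.ten_mul_pow_le (show 1 < 4 by norm_num)) hh
  have e : 0 ≤ Q ^ 4 * |t - s| ^ (2 * α) := by positivity
  have a1 := hA s hs l
  have a2 := hA t ht l
  rcases le_total s t with hst | hst
  · have h := H.remainder_le s t hs.1 hst ht.2 l
    rw [abs_of_nonneg (show 0 ≤ t - s by linarith)] at *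
    simp only [mul_comm (A' s _ _)]
    rw [abs_le] at *
    constructor <;> linarith
  · have h := H.remainder_le t s ht.1 hst hs.2 l
    have h0 : 0 ≤ s - t := by linarith
    rw [abs_sub_comm t s, abs_of_nonneg h0] at *
    have h1 := abs_sum_mul_le (fun k => H.deriv_le t s ht.1 hst hs.2 k l)
      (H.path_le t s ht.1 hst hs.2)
    have h2 : (s - t) ^ (2 * α) = (s - t) ^ α * (s - t) ^ α := by
      rw [← Real.rpow_add' h0 (by linarith)]; congr 1; ring
    have h3 := H.dim_mul_le (x := Q * (s - t) ^ α * (Q * (s - t) ^ α)) (by positivity)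
    have h4 : ∑ k, A' s k l * (X t k - X s k) = -(∑ k, (A' s k l - A' t k l) * (X s k - X t k)
        + ∑ k, (X s k - X t k) * A' t k l) := by
      rw [← Finset.sum_add_distrib, ← Finset.sum_neg_distrib]
      exact Finset.sum_congr rfl fun k _ => by ring
    have h5 : Q * (Q * (s - t) ^ α * (Q * (s - t) ^ α)) = Q ^ 3 * (s - t) ^ (2 * α) := by
      rw [h2]; ring
    rw [h4, abs_neg]
    rw [abs_le] at *
    constructor <;> linarith

lemma exponent_mem (H : NorrisBounds T α θ Q X XX A A' B Z) :
    0 < 1 - θ / (2 * α) ∧ 1 - θ / (2 * α) < 1 := by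
  have ha := H.lt_alpha
  have h1 : θ / (2 * α) < 1 := by rw [div_lt_one (by linarith)]; exact H.theta_lt
  have h2 : 0 < θ / (2 * α) := div_pos (by linarith [H.lt_theta]) (by linarith)
  constructor <;> linarith

lemma deriv_small (H : NorrisBounds T α θ Q X XX A A' B Z)
    (hZ : ∀ t ∈ Set.Icc 0 T, |Z t| ≤ w) (hw : 0 < w) (hw1 : w ≤ 1) {s : ℝ}
    (hs : s ∈ Set.Icc 0 T) (k l : Fin n) :
    |A' s k l| ≤ Q ^ 16 * (w ^ (1 - θ / (2 * α))) ^ (1 - θ / (2 * α)) := by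
  have hQ := H.Q_pos
  have ha := H.lt_alpha
  have h := abs_le_of_holderRough H.T_pos (show 0 < 2 * α by linarith) (inv_pos.2 hQ)
    (w := w ^ (1 - θ / (2 * α))) (N := 2 * Q ^ 13) (M := Q ^ 4)
    (by positivity) (Real.rpow_le_one hw.le hw1 H.exponent_mem.1.le)
    (by positivity) (by positivity) H.rough hs (fun k => A' s k l)
    (fun t ht => (H.deriv_incr_le
      (fun t ht k => H.integrand_small hZ hw hw1 ht k) hs ht l).trans_eq (by ring)) k
  refine h.trans ?_
  rw [inv_inv, ← mul_assoc]
  have hT := H.T_pos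
  gcongr
  have h1 := H.rpow_le (T / 4) (2 * α) (by linarith) (by linarith) (by linarith)
    (by linarith [H.alpha_lt])
  calc Q * ((T / 4) ^ (-θ) * (2 * Q ^ 13 + Q ^ 4 * (T / 4) ^ (2 * α)))
      ≤ Q * (Q * (2 * Q ^ 13 + Q ^ 4 * Q)) := by gcongr; exact H.scale_le
    _ ≤ Q ^ 16 := by
      have p1 := H.ten_mul_pow_le (show 15 < 16 by norm_num)
      have p2 := H.ten_mul_pow_le (show 7 < 16 by norm_num)
      have := pow_pos hQ 16
      linarith

lemma drift_forward_le (H : NorrisBounds T α θ Q X XX A A' B Z) {v : ℝ}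
    (hZ : ∀ t ∈ Set.Icc 0 T, |Z t| ≤ v)
    (hA : ∀ t ∈ Set.Icc 0 T, ∀ k, |A t k| ≤ Q ^ 13 * v)
    (hA' : ∀ t ∈ Set.Icc 0 T, ∀ k l, |A' t k l| ≤ Q ^ 16 * v) (hv : 0 < v) {s t : ℝ}
    (hs : 0 ≤ s) (hst : s ≤ t) (ht : t ≤ T) :
    |B s| * (t - s) ≤ Q ^ 22 * v + Q ^ 3 * (t - s) ^ (3 * α) := by
  have hQ := H.Q_pos
  have ha := H.lt_alpha
  have ha' := H.alpha_lt
  have h0 : 0 ≤ t - s := by linarith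
  have hhT : t - s ≤ T := by linarith
  have hh : 0 ≤ (t - s) ^ (3 * α) := by positivity
  have hsI : s ∈ Set.Icc 0 T := ⟨hs, hst.trans ht⟩
  have h1 := H.integral_le s t hs hst ht
  have h2 := H.area_sum_le hs hst ht (by positivity) (hA' s hsI)
  have h3 := abs_sum_mul_le (H.path_le s t hs hst ht) (hA s hsI)
  have h4 := H.dim_mul_le (x := Q * (t - s) ^ α * (Q ^ 13 * v)) (by positivity)
  have h5 := H.rpow_le (t - s) α h0 hhT (by linarith) (by linarith)
  have h6 := H.rpow_le (t - s) (2 * α) h0 hhT (by linarith) (by linarith)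
  have h7 := H.rpow_le_mul_rpow h0 hhT (by linarith) (show 3 * α ≤ 1 + α by linarith)
    (by linarith)
  have h5' := mul_le_mul_of_nonneg_left h5 (show 0 ≤ Q ^ 15 * v by positivity)
  have h6' := mul_le_mul_of_nonneg_left h6 (show 0 ≤ Q ^ 4 * (Q ^ 16 * v) by positivity)
  have h7' := mul_le_mul_of_nonneg_left h7 hQ.le
  have z1 := abs_le.1 (hZ t ⟨hs.trans hst, ht⟩)
  have z2 := abs_le.1 (hZ s hsI)
  have p1 := mul_le_mul_of_nonneg_right (H.ten_mul_pow_le (show 21 < 22 by norm_num)) hv.le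
  have p2 := mul_le_mul_of_nonneg_right (H.ten_mul_pow_le (show 16 < 22 by norm_num)) hv.le
  have p3 := mul_le_mul_of_nonneg_right (H.ten_mul_pow_le (show 0 < 22 by norm_num)) hv.le
  have p4 := mul_le_mul_of_nonneg_right (H.ten_mul_pow_le (show 1 < 3 by norm_num)) hh
  have p5 := mul_le_mul_of_nonneg_right (H.ten_mul_pow_le (show 2 < 3 by norm_num)) hh
  have e : 0 ≤ Q ^ 22 * v := by positivity
  have e' : 0 ≤ Q ^ 3 * (t - s) ^ (3 * α) := by positivity
  rw [← abs_of_nonneg h0, ← abs_mul, abs_of_nonneg h0]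
  rw [abs_le] at *
  constructor <;> linarith

lemma drift_scale_le (H : NorrisBounds T α θ Q X XX A A' B Z) {v : ℝ}
    (hZ : ∀ t ∈ Set.Icc 0 T, |Z t| ≤ v)
    (hA : ∀ t ∈ Set.Icc 0 T, ∀ k, |A t k| ≤ Q ^ 13 * v)
    (hA' : ∀ t ∈ Set.Icc 0 T, ∀ k l, |A' t k l| ≤ Q ^ 16 * v) (hv : 0 < v) {s h : ℝ}
    (hs : s ∈ Set.Icc 0 T) (h0 : 0 < h) (hhT : h ≤ T / 2) :
    |B s| * h ≤ Q ^ 22 * v + Q ^ 4 * h ^ (3 * α) := by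
  have hQ := H.Q_pos
  have ha := H.lt_alpha
  have ha' := H.alpha_lt
  have hh : 0 ≤ h ^ (3 * α) := by positivity
  have p1 := mul_le_mul_of_nonneg_right (H.ten_mul_pow_le (show 3 < 4 by norm_num)) hh
  have p2 := mul_le_mul_of_nonneg_right (H.ten_mul_pow_le (show 2 < 4 by norm_num)) hh
  have e : 0 ≤ Q ^ 4 * h ^ (3 * α) := by positivity
  rcases le_total s (T / 2) with hsT | hsT
  · have := H.drift_forward_le hZ hA hA' hv hs.1 (show s ≤ s + h by linarith) (by linarith)
    rw [add_sub_cancel_left] at this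
    linarith
  · have h1 := H.drift_forward_le hZ hA hA' hv (show 0 ≤ s - h by linarith)
      (show s - h ≤ s by linarith) hs.2
    have h2 := H.drift_incr_le (s - h) s (by linarith) (by linarith) hs.2
    rw [sub_sub_cancel] at h1 h2
    have h3 := H.rpow_le_mul_rpow h0.le (by linarith) (by linarith)
      (show 3 * α ≤ α + 1 by linarith) (by linarith)
    rw [Real.rpow_add_one h0.ne'] at h3
    have h4 := abs_sub_abs_le_abs_sub (B s) (B (s - h))
    have h5 := mul_le_mul_of_nonneg_right (h4.trans h2) h0.le
    have h6 := mul_le_mul_of_nonneg_left h3 hQ.le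
    linarith

lemma drift_small (H : NorrisBounds T α θ Q X XX A A' B Z) {v : ℝ}
    (hZ : ∀ t ∈ Set.Icc 0 T, |Z t| ≤ v)
    (hA : ∀ t ∈ Set.Icc 0 T, ∀ k, |A t k| ≤ Q ^ 13 * v)
    (hA' : ∀ t ∈ Set.Icc 0 T, ∀ k l, |A' t k l| ≤ Q ^ 16 * v) (hv : 0 < v) (hv1 : v ≤ 1)
    {s : ℝ} (hs : s ∈ Set.Icc 0 T) :
    |B s| ≤ Q ^ 24 * v ^ (1 - 1 / (3 * α)) := by
  have hQ := H.Q_pos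
  have ha := H.lt_alpha
  have hT := H.T_pos
  have hγ : 0 < 3 * α := by linarith
  have hv1' : v ^ (1 / (3 * α)) ≤ 1 := Real.rpow_le_one hv.le hv1 (by positivity)
  have h := le_rpow_of_scale_bound (c := T / 4) (q := 1) (y := |B s|) (by positivity) hγ hv
    (N := Q ^ 22) (M := Q ^ 4)
    (by rw [Real.rpow_one]
        exact H.drift_scale_le hZ hA hA' hv hs (by positivity) (by nlinarith))
  refine h.trans ?_
  gcongr
  have h1 := H.rpow_le (T / 4) (3 * α) (by linarith) (by linarith) (by linarith)
    (by linarith [H.alpha_lt])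
  calc (T / 4) ^ (-1 : ℝ) * (Q ^ 22 + Q ^ 4 * (T / 4) ^ (3 * α))
      ≤ Q * (Q ^ 22 + Q ^ 4 * Q) := by gcongr; exact H.scale_inv_le
    _ ≤ Q ^ 24 := by
      have p1 := H.ten_mul_pow_le (show 23 < 24 by norm_num)
      have p2 := H.ten_mul_pow_le (show 6 < 24 by norm_num)
      have := pow_pos hQ 24
      linarith

lemma exists_integral_bound (H : NorrisBounds T α θ Q X XX A A' B Z) :
    ∃ c, ∀ t ∈ Set.Icc 0 T, |Z t| ≤ c := by
  have hQ := H.Q_pos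
  have ha := H.lt_alpha
  have ha' := H.alpha_lt
  have h0T : (0 : ℝ) ∈ Set.Icc 0 T := ⟨le_rfl, H.T_pos.le⟩
  refine ⟨|Z 0| + Q * T + n * (Q * Q * Q ^ 8) + Q ^ 4 * Q ^ 3 * Q + Q * (Q + Q * Q),
    fun t ht => ?_⟩
  have h1 := H.integral_le 0 t le_rfl ht.1 ht.2
  have h2 := H.area_sum_le le_rfl ht.1 ht.2 (by positivity) (fun k l => H.deriv_abs_le h0T k l)
  have h3 := abs_sum_mul_le (H.path_le 0 t le_rfl ht.1 ht.2) (fun k => H.integrand_abs_le h0T k)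
  rw [sub_zero] at h1 h2 h3
  have h4 : |B 0 * t| ≤ Q * T := by
    rw [abs_mul, abs_of_nonneg ht.1]
    exact mul_le_mul (H.drift_le 0 h0T) ht.2 ht.1 hQ.le
  have h5 := H.rpow_le t α ht.1 ht.2 (by linarith) (by linarith)
  have h6 := H.rpow_le t (2 * α) ht.1 ht.2 (by linarith) (by linarith)
  have h7 := H.rpow_le t (3 * α) ht.1 ht.2 (by linarith) (by linarith)
  have h8 := H.rpow_le t (1 + α) ht.1 ht.2 (by linarith) (by linarith)
  have h3' : (n : ℝ) * (Q * t ^ α * Q ^ 8) ≤ n * (Q * Q * Q ^ 8) := by gcongr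
  have h2' := mul_le_mul_of_nonneg_left h6 (show 0 ≤ Q ^ 4 * Q ^ 3 by positivity)
  have h1' := mul_le_mul_of_nonneg_left (add_le_add h7 h8) hQ.le
  have h9 : Q * (Q + Q) ≤ Q * (Q + Q * Q) := by
    gcongr; nlinarith [H.ten_le]
  have h10 := abs_le.1 (le_refl |Z 0|)
  rw [abs_le] at h1 h2 h3 h4 ⊢
  constructor <;> linarith

lemma integrand_add_drift_le (H : NorrisBounds T α θ Q X XX A A' B Z)
    (hZ : ∀ t ∈ Set.Icc 0 T, |Z t| ≤ w) (hw : 0 < w) {s t : ℝ}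
    (hs : s ∈ Set.Icc 0 T) (ht : t ∈ Set.Icc 0 T) :
    Real.sqrt (∑ k, A s k ^ 2) + |B t|
      ≤ Q ^ 25 * w ^ ((1 - θ / (2 * α)) * (1 - θ / (2 * α)) * (1 - 1 / (3 * α))) := by
  have hQ := H.Q_pos
  have ha := H.lt_alpha
  obtain ⟨hρ, hρ1⟩ := H.exponent_mem
  set ρ := 1 - θ / (2 * α) with hρdef
  have h3 : 0 < 1 / (3 * α) := by positivity
  have h3' : 1 / (3 * α) < 1 := by rw [div_lt_one (by linarith)]; linarith
  set τ := 1 - 1 / (3 * α) with hτdef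
  have hτ : 0 < τ := by linarith
  have hτ1 : τ ≤ 1 := by linarith
  rcases le_total w 1 with hw1 | hw1
  · have hσρ : ρ * ρ ≤ ρ := by nlinarith
    have hw1ρ : w ≤ w ^ (ρ * ρ) := by
      simpa using Real.rpow_le_rpow_of_exponent_ge hw hw1 (show ρ * ρ ≤ 1 by linarith)
    have hwρρ : w ^ ρ ≤ w ^ (ρ * ρ) := Real.rpow_le_rpow_of_exponent_ge hw hw1 hσρ
    have hwr : w ^ (ρ * ρ) ≤ w ^ (ρ * ρ * τ) :=
      Real.rpow_le_rpow_of_exponent_ge hw hw1 (by nlinarith [mul_pos hρ hρ])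
    have hA : ∀ t ∈ Set.Icc 0 T, ∀ k, |A t k| ≤ Q ^ 13 * w ^ (ρ * ρ) := fun t ht k =>
      (H.integrand_small hZ hw hw1 ht k).trans (by gcongr)
    have hB := H.drift_small (v := w ^ (ρ * ρ)) (fun t ht => (hZ t ht).trans hw1ρ) hA
      (fun t ht k l => by
        rw [Real.rpow_mul hw.le]; exact H.deriv_small hZ hw hw1 ht k l)
      (by positivity) (Real.rpow_le_one hw.le hw1 (by positivity)) ht
    rw [← Real.rpow_mul hw.le] at hB
    have hS := sqrt_sum_sq_le (by positivity) (hA s hs)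
    have h4 := H.dim_mul_le (x := Q ^ 13 * w ^ (ρ * ρ)) (by positivity)
    have h5 := mul_le_mul_of_nonneg_left hwr (show 0 ≤ Q ^ 14 by positivity)
    have hp : 0 ≤ w ^ (ρ * ρ * τ) := by positivity
    have p1 := mul_le_mul_of_nonneg_right (H.ten_mul_pow_le (show 24 < 25 by norm_num)) hp
    have p2 := mul_le_mul_of_nonneg_right (H.ten_mul_pow_le (show 14 < 25 by norm_num)) hp
    have : 0 ≤ Q ^ 25 * w ^ (ρ * ρ * τ) := by positivity
    linarith
  · have hS := sqrt_sum_sq_le (by positivity) (fun k => H.integrand_abs_le hs k)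
    have h4 := H.dim_mul_le (x := Q ^ 8) (by positivity)
    have hB := H.drift_le t ht
    have hp : 1 ≤ w ^ (ρ * ρ * τ) := Real.one_le_rpow hw1 (by positivity)
    have p1 := H.ten_mul_pow_le (show 9 < 25 by norm_num)
    have p2 := H.ten_mul_pow_le (show 1 < 25 by norm_num)
    have p3 := pow_pos hQ 25
    have p4 := mul_le_mul_of_nonneg_left hp p3.le
    linarith

end NorrisBounds

/-- Norris-type lemma for rough paths (concrete form).  Fix `T > 0`, `α ∈ (1/3, 1/2)`,
`θ ∈ (1/2, 2α)` and `n ≥ 1`.  There are constants `C, p, r > 0` (depending only on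
`α, θ, n, T`) such that, whenever `(X, 𝕏)` is an `α`-Hölder rough path in `ℝⁿ` (encoded
by Hölder bounds `CX, CXX` and Chen's relation) which is `θ`-Hölder rough on scale `T/2`
with modulus `L > 0`, `(A, A')` is controlled by `X` with values in `L(ℝⁿ, ℝ)` (encoded
componentwise, with bounds `CA'` for `‖A'‖_α` and `CRA` for `‖R^A‖_{2α}`), `B` is
`α`-Hölder with bound `CB`, and `Z` satisfies
`|Z_t - Z_s - B_s (t-s) - A_s X_{s,t} - A'_s 𝕏_{s,t}| ≤ K ((t-s)^{3α} + (t-s)^{1+α})`,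
then `sup |A| + sup |B| ≤ C ℛ^p (sup |Z|)^r`, with
`ℛ = 1 + L⁻¹ + ‖X‖_α + ‖𝕏‖_{2α}^{1/2} + |A₀| + |A'₀| + ‖A'‖_α + ‖R^A‖_{2α}
     + sup |B| + ‖B‖_α + K`. -/
theorem statement11 (T α θ : ℝ) (n : ℕ) (hT : 0 < T) (hα : 1 / 3 < α) (hα' : α < 1 / 2)
    (hθ : 1 / 2 < θ) (hθ' : θ < 2 * α) (hn : 1 ≤ n) :
    ∃ C > (0 : ℝ), ∃ p > (0 : ℝ), ∃ r > (0 : ℝ),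
      ∀ (X : ℝ → EuclideanSpace ℝ (Fin n))
        (XX : ℝ → ℝ → EuclideanSpace ℝ (Fin n × Fin n))
        (L : ℝ) (A : ℝ → Fin n → ℝ) (A' : ℝ → Fin n → Fin n → ℝ)
        (B Z : ℝ → ℝ) (K : ℝ) (CX CXX CA' CRA CB : ℝ),
        0 < L → 0 ≤ K →
        -- `‖X‖_α ≤ CX`
        (∀ s t : ℝ, 0 ≤ s → s ≤ t → t ≤ T → ‖X t - X s‖ ≤ CX * (t - s) ^ α) →
        -- `‖𝕏‖_{2α} ≤ CXX`
        (∀ s t : ℝ, 0 ≤ s → s ≤ t → t ≤ T → ‖XX s t‖ ≤ CXX * (t - s) ^ (2 * α)) →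
        -- Chen's relation
        (∀ s u t : ℝ, 0 ≤ s → s ≤ u → u ≤ t → t ≤ T → ∀ q : Fin n × Fin n,
          XX s t q = XX s u q + XX u t q + (X u q.1 - X s q.1) * (X t q.2 - X u q.2)) →
        -- `X` is `θ`-Hölder rough on scale `T/2` with modulus `L`
        (∀ φ : EuclideanSpace ℝ (Fin n), φ ≠ 0 →
          ∀ s ∈ Set.Icc (0 : ℝ) T, ∀ ε : ℝ, 0 < ε → ε < T / 2 →
            ∃ t ∈ Set.Icc (0 : ℝ) T, |t - s| ≤ ε ∧
              L * ε ^ θ * ‖φ‖ ≤ |∑ k : Fin n, φ k * (X t k - X s k)|) →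
        -- `‖A'‖_α ≤ CA'`
        (∀ s t : ℝ, 0 ≤ s → s ≤ t → t ≤ T →
          Real.sqrt (∑ k : Fin n, ∑ l : Fin n, (A' t k l - A' s k l) ^ 2)
            ≤ CA' * (t - s) ^ α) →
        -- remainder bound `‖R^A_{s,t}‖ ≤ CRA (t-s)^{2α}`, `R^A_{s,t} = A_t - A_s - A'_s X_{s,t}`
        (∀ s t : ℝ, 0 ≤ s → s ≤ t → t ≤ T →
          Real.sqrt (∑ l : Fin n,
              (A t l - A s l - ∑ k : Fin n, (X t k - X s k) * A' s k l) ^ 2)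
            ≤ CRA * (t - s) ^ (2 * α)) →
        -- `‖B‖_α ≤ CB`
        (∀ s t : ℝ, 0 ≤ s → s ≤ t → t ≤ T → |B t - B s| ≤ CB * (t - s) ^ α) →
        -- `Z` is the rough integral of `(A, A')` against `X` plus the drift `B`, up to `K`-error
        (∀ s t : ℝ, 0 ≤ s → s ≤ t → t ≤ T →
          |Z t - Z s - B s * (t - s) - (∑ k : Fin n, (X t k - X s k) * A s k)
              - ∑ k : Fin n, ∑ l : Fin n, XX s t (k, l) * A' s k l|
            ≤ K * ((t - s) ^ (3 * α) + (t - s) ^ (1 + α))) →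
        (⨆ t : Set.Icc (0 : ℝ) T, Real.sqrt (∑ k : Fin n, (A t.1 k) ^ 2))
          + (⨆ t : Set.Icc (0 : ℝ) T, |B t.1|)
        ≤ C * (1 + L⁻¹ + CX + Real.sqrt CXX
              + Real.sqrt (∑ k : Fin n, (A 0 k) ^ 2)
              + Real.sqrt (∑ k : Fin n, ∑ l : Fin n, (A' 0 k l) ^ 2)
              + CA' + CRA + (⨆ t : Set.Icc (0 : ℝ) T, |B t.1|) + CB + K) ^ p
            * (⨆ t : Set.Icc (0 : ℝ) T, |Z t.1|) ^ r := by
  set d : ℝ := 10 + n + (1 + T) ^ 2 + (T / 4) ^ (-θ) + (T / 4) ^ (-1 : ℝ) with hd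
  clear_value d
  have hd1 : 0 < (T / 4) ^ (-θ) := by positivity
  have hd2 : 0 < (T / 4) ^ (-1 : ℝ) := by positivity
  have hd3 : (0 : ℝ) ≤ n := by positivity
  have hd4 : 0 < (1 + T) ^ 2 := by positivity
  have hd10 : 10 ≤ d := by linarith
  have hd0 : 0 < d := by linarith
  have hτ : 0 < 1 - 1 / (3 * α) := by
    rw [sub_pos, div_lt_one (by linarith)]; linarith
  have hρ : 0 < 1 - θ / (2 * α) := by
    rw [sub_pos, div_lt_one (by linarith)]; linarith
  refine ⟨d ^ 25, by positivity, 25, by norm_num,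
    (1 - θ / (2 * α)) * (1 - θ / (2 * α)) * (1 - 1 / (3 * α)), by positivity, ?_⟩
  intro X XX L A A' B Z K CX CXX CA' CRA CB hL hK hX hXX _ hrough hA' hRA hB hZ
  have hTα : 0 < T ^ α := by positivity
  have hTα2 : 0 < T ^ (2 * α) := by positivity
  have nonneg_of : ∀ {x c y : ℝ}, 0 ≤ x → x ≤ c * y → 0 < y → 0 ≤ c := fun hx h hy =>
    nonneg_of_mul_nonneg_left (hx.trans h) hy
  have hCX := nonneg_of (norm_nonneg _) (hX 0 T le_rfl hT.le le_rfl) (by simpa using hTα)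
  have hCXX := nonneg_of (norm_nonneg _) (hXX 0 T le_rfl hT.le le_rfl) (by simpa using hTα2)
  have hCA' := nonneg_of (Real.sqrt_nonneg _) (hA' 0 T le_rfl hT.le le_rfl)
    (by simpa using hTα)
  have hCRA := nonneg_of (Real.sqrt_nonneg _) (hRA 0 T le_rfl hT.le le_rfl)
    (by simpa using hTα2)
  have hCB := nonneg_of (abs_nonneg _) (hB 0 T le_rfl hT.le le_rfl) (by simpa using hTα)
  have h0T : (0 : ℝ) ∈ Set.Icc 0 T := ⟨le_rfl, hT.le⟩
  have hpow : ∀ h γ : ℝ, 0 ≤ h → h ≤ T → 0 ≤ γ → γ ≤ 2 → h ^ γ ≤ (1 + T) ^ 2 := by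
    intro h γ h0 hhT hγ hγ2
    calc h ^ γ ≤ (1 + T) ^ γ := Real.rpow_le_rpow h0 (by linarith) hγ
      _ ≤ (1 + T) ^ (2 : ℝ) := Real.rpow_le_rpow_of_exponent_le (by linarith) hγ2
      _ = (1 + T) ^ 2 := by norm_cast
  have hbdd : ∀ {f : ℝ → ℝ} {c : ℝ}, (∀ t ∈ Set.Icc 0 T, f t ≤ c) →
      BddAbove (Set.range fun t : Set.Icc (0 : ℝ) T => f t.1) := by
    rintro f c hf
    exact ⟨c, by rintro _ ⟨t, rfl⟩; exact hf t.1 t.2⟩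
  have hBbdd : BddAbove (Set.range fun t : Set.Icc (0 : ℝ) T => |B t.1|) := by
    apply hbdd (f := fun t => |B t|) (c := |B 0| + CB * (1 + T) ^ 2)
    intro t ht
    have h1 := hB 0 t le_rfl ht.1 ht.2
    have h2 := mul_le_mul_of_nonneg_left
      (hpow t α ht.1 ht.2 (by linarith) (by linarith)) hCB
    rw [sub_zero] at h1
    have h3 := abs_sub_abs_le_abs_sub (B t) (B 0)
    linarith
  have hBsup : ∀ t ∈ Set.Icc 0 T, |B t| ≤ ⨆ t : Set.Icc (0 : ℝ) T, |B t.1| := fun t ht =>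
    le_ciSup hBbdd ⟨t, ht⟩
  set b := ⨆ t : Set.Icc (0 : ℝ) T, |B t.1| with hb
  have hb0 : 0 ≤ b := (abs_nonneg _).trans (hBsup 0 h0T)
  set a₀ := Real.sqrt (∑ k : Fin n, (A 0 k) ^ 2) with ha₀
  set a₁ := Real.sqrt (∑ k : Fin n, ∑ l : Fin n, (A' 0 k l) ^ 2) with ha₁
  have ha₀' : 0 ≤ a₀ := Real.sqrt_nonneg _
  have ha₁' : 0 ≤ a₁ := Real.sqrt_nonneg _
  have hsC : 0 ≤ Real.sqrt CXX := Real.sqrt_nonneg _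
  have hLi : 0 < L⁻¹ := inv_pos.2 hL
  set R := 1 + L⁻¹ + CX + Real.sqrt CXX + a₀ + a₁ + CA' + CRA + b + CB + K with hR
  clear_value R a₀ a₁ b
  have hR1 : 1 ≤ R := by linarith
  have hLR : L⁻¹ ≤ R := by linarith
  have hCXR : CX ≤ R := by linarith
  have hCXXR : Real.sqrt CXX ≤ R := by linarith
  have ha₀R : a₀ ≤ R := by linarith
  have ha₁R : a₁ ≤ R := by linarith
  have hCA'R : CA' ≤ R := by linarith
  have hCRAR : CRA ≤ R := by linarith
  have hbR : b ≤ R := by linarith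
  have hCBR : CB ≤ R := by linarith
  have hKR : K ≤ R := by linarith
  have hRQ : R ≤ d * R := le_mul_of_one_le_left (zero_le_one.trans hR1) (by linarith)
  have hdQ : d ≤ d * R := le_mul_of_one_le_right hd0.le hR1
  have hQ0 : 0 < d * R := hd0.trans_le hdQ
  have hQL : (d * R)⁻¹ ≤ L := (inv_le_comm₀ hQ0 hL).2 (hLR.trans hRQ)
  have hentry : ∀ (x : Fin n → Fin n → ℝ) k l,
      |x k l| ≤ Real.sqrt (∑ k, ∑ l, x k l ^ 2) := by
    intro x k l
    have := abs_le_sqrt_sum_sq (fun q : Fin n × Fin n => x q.1 q.2) (k, l)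
    rwa [Fintype.sum_prod_type] at this
  have hmono : ∀ {x c y : ℝ}, x ≤ c * y → 0 ≤ y → c ≤ R → x ≤ d * R * y := fun h hy hc =>
    h.trans (mul_le_mul_of_nonneg_right (hc.trans hRQ) hy)
  have H : NorrisBounds T α θ (d * R) X (fun s t k l => XX s t (k, l)) A A' B Z :=
    { T_pos := hT
      lt_alpha := hα
      alpha_lt := hα'
      lt_theta := hθ
      theta_lt := hθ'
      ten_le := hd10.trans hdQ
      dim_le := le_trans (by linarith) hdQ
      rpow_le := fun h γ h0 hhT hγ hγ2 =>
        (hpow h γ h0 hhT hγ hγ2).trans (le_trans (by linarith) hdQ)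
      scale_le := le_trans (by linarith) hdQ
      scale_inv_le := le_trans (by linarith) hdQ
      path_le := fun s t hs hst ht k => by
        have h1 : |X t k - X s k| ≤ ‖X t - X s‖ := by
          simpa using PiLp.norm_apply_le (X t - X s) k
        exact hmono (h1.trans (hX s t hs hst ht)) (Real.rpow_nonneg (by linarith) _)
          hCXR
      area_le := fun s t hs hst ht k l => by
        have h1 : |XX s t (k, l)| ≤ ‖XX s t‖ := by
          simpa using PiLp.norm_apply_le (XX s t) (k, l)
        refine (h1.trans (hXX s t hs hst ht)).trans
          (mul_le_mul_of_nonneg_right ?_ (Real.rpow_nonneg (by linarith) _))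
        rw [← Real.sq_sqrt hCXX]
        exact pow_le_pow_left₀ hsC (hCXXR.trans hRQ) 2
      rough := fun φ hφ s hs ε hε hεT => by
        obtain ⟨t, ht, hts, h⟩ := hrough φ hφ s hs ε hε hεT
        refine ⟨t, ht, hts, le_trans ?_ h⟩
        exact mul_le_mul_of_nonneg_right
          (mul_le_mul_of_nonneg_right hQL (Real.rpow_nonneg hε.le _)) (norm_nonneg _)
      init_le := fun k => ((abs_le_sqrt_sum_sq (A 0) k).trans_eq ha₀.symm).trans (ha₀R.trans hRQ)
      deriv_init_le := fun k l => ((hentry (A' 0) k l).trans_eq ha₁.symm).trans (ha₁R.trans hRQ)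
      deriv_le := fun s t hs hst ht k l =>
        hmono ((hentry (fun k l => A' t k l - A' s k l) k l).trans (hA' s t hs hst ht))
          (Real.rpow_nonneg (by linarith) _) hCA'R
      remainder_le := fun s t hs hst ht l =>
        hmono ((abs_le_sqrt_sum_sq
          (fun l => A t l - A s l - ∑ k : Fin n, (X t k - X s k) * A' s k l) l).trans
            (hRA s t hs hst ht)) (Real.rpow_nonneg (by linarith) _) hCRAR
      drift_le := fun s hs => (hBsup s hs).trans (hbR.trans hRQ)
      drift_incr_le := fun s t hs hst ht =>
        hmono (hB s t hs hst ht) (Real.rpow_nonneg (by linarith) _) hCBR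
      integral_le := fun s t hs hst ht => by
        have h0 : 0 ≤ t - s := by linarith
        exact hmono (hZ s t hs hst ht) (by positivity) hKR }
  obtain ⟨c, hc⟩ := H.exists_integral_bound
  have hZsup : ∀ t ∈ Set.Icc 0 T, |Z t| ≤ ⨆ t : Set.Icc (0 : ℝ) T, |Z t.1| := fun t ht =>
    le_ciSup (f := fun t : Set.Icc (0 : ℝ) T => |Z t.1|) (hbdd (f := fun t => |Z t|) hc) ⟨t, ht⟩
  set z := ⨆ t : Set.Icc (0 : ℝ) T, |Z t.1| with hz
  have hz0 : 0 ≤ z := (abs_nonneg _).trans (hZsup 0 h0T)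
  set r := (1 - θ / (2 * α)) * (1 - θ / (2 * α)) * (1 - 1 / (3 * α)) with hr
  have hr0 : 0 < r := by positivity
  have key : ∀ w, z < w →
      (⨆ t : Set.Icc (0 : ℝ) T, Real.sqrt (∑ k : Fin n, (A t.1 k) ^ 2)) + b
        ≤ d ^ 25 * R ^ (25 : ℝ) * w ^ r := by
    intro w hw
    have : Nonempty (Set.Icc (0 : ℝ) T) := ⟨⟨0, h0T⟩⟩
    have hbound := fun {s t : ℝ} hs ht => H.integrand_add_drift_le (s := s) (t := t)
      (fun t ht => (hZsup t ht).trans hw.le) (hz0.trans_lt hw) hs ht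
    have e : d ^ 25 * R ^ (25 : ℝ) = (d * R) ^ 25 := by
      rw [mul_pow]; norm_cast
    rw [e, ← le_sub_iff_add_le]
    refine ciSup_le fun s => ?_
    rw [le_sub_comm, hb]
    refine ciSup_le fun t => ?_
    linarith [hbound s.2 t.2]
  have hcont : Tendsto (fun w : ℝ => d ^ 25 * R ^ (25 : ℝ) * w ^ r) (nhdsWithin z (Set.Ioi z))
      (nhds (d ^ 25 * R ^ (25 : ℝ) * z ^ r)) :=
    (((Real.continuousAt_rpow_const z r (Or.inr hr0.le)).const_mul _).tendsto).mono_left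
      nhdsWithin_le_nhds
  exact ge_of_tendsto hcont (eventually_nhdsWithin_of_forall fun w hw => key w hw)
end
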